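/- arXiv:1910.03884 — 3 statements merged into one kernel-verified Lean document; each statement's English description precedes it below -/
import Mathlib

section
/- Let n ≥ 1, 0 < p < 1 and 0 < q, θ < ∞. Let u, w be weights on (0,∞) and v a weight on ℝⁿ. Define ṽ(t) := (∫_{S^{n-1}} v(t s')^{1/(1-p)} dσ(s'))^{1-p} · t^{(n-1)(1-p)} for t > 0. Then the following are equivalent: (i) there exists a constant C such that (∫₀^∞ (∫_{B(0,t)} f(s)^p v(s) ds)^{q/p} u(t) dt)^{1/q} ≤ C (∫₀^∞ (∫_{B(0,t)} f(s) ds)^θ w(t) dt)^{1/θ} for every nonnegative measurable f on ℝⁿ; (ii) there exists a constant C' such that (∫₀^∞ (∫₀^t g(s)^p ṽ(s) ds)^{q/p} u(t) dt)^{1/q} ≤ C' (∫₀^∞ (∫₀^t g(s) ds)^θ w(t) dt)^{1/θ} for every nonnegative measurable g on (0,∞). Moreover, the best (least) constants in the two inequalities are equal: C = C'. -/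
open MeasureTheory Set ENNReal

noncomputable section

/-- The set `B(a,b) = {y ∈ ℝⁿ : a < |y| < b}`. -/
def annulus (n : ℕ) (a b : ℝ) : Set (EuclideanSpace ℝ (Fin n)) :=
  {y | a < ‖y‖ ∧ ‖y‖ < b}

section helpers

variable {n : ℕ} {σ : Measure (Metric.sphere (0 : EuclideanSpace ℝ (Fin n)) 1)}

def Polar (n : ℕ) (σ : Measure (Metric.sphere (0 : EuclideanSpace ℝ (Fin n)) 1)) : Prop :=
  ∀ f : EuclideanSpace ℝ (Fin n) → ℝ≥0∞, Measurable f →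
      (∫⁻ x, f x) = ∫⁻ τ in Ioi (0 : ℝ),
        ∫⁻ s', f (τ • (s' : EuclideanSpace ℝ (Fin n))) * ENNReal.ofReal (τ ^ (n - 1)) ∂σ

lemma norm_smul_sphere {τ : ℝ} (hτ : 0 < τ)
    (s' : Metric.sphere (0 : EuclideanSpace ℝ (Fin n)) 1) :
    ‖τ • (s' : EuclideanSpace ℝ (Fin n))‖ = τ := by
  rw [norm_smul, norm_eq_of_mem_sphere s', mul_one, Real.norm_of_nonneg hτ.le]

lemma sigma_finite (hσ : Polar n σ) : IsFiniteMeasure σ := by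
  refine ⟨lt_top_iff_ne_top.2 fun htop => ?_⟩
  have h := hσ ((Metric.ball 0 1).indicator 1)
    (measurable_one.indicator Metric.isOpen_ball.measurableSet)
  rw [lintegral_indicator_one Metric.isOpen_ball.measurableSet] at h
  have h1 : (⊤ : ℝ≥0∞) ≤ volume (Metric.ball (0 : EuclideanSpace ℝ (Fin n)) 1) := by
    rw [h]
    calc (⊤ : ℝ≥0∞) = ∫⁻ τ in Ioo (0 : ℝ) 1, ⊤ := by simp
      _ ≤ ∫⁻ τ in Ioo (0 : ℝ) 1, ∫⁻ s', (Metric.ball 0 1).indicator 1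
            (τ • (s' : EuclideanSpace ℝ (Fin n))) * ENNReal.ofReal (τ ^ (n - 1)) ∂σ := by
          refine setLIntegral_mono' measurableSet_Ioo fun τ hτ => ?_
          have : ∀ s' : Metric.sphere (0 : EuclideanSpace ℝ (Fin n)) 1,
              (Metric.ball 0 1).indicator (1 : EuclideanSpace ℝ (Fin n) → ℝ≥0∞)
            (τ • (s' : EuclideanSpace ℝ (Fin n))) * ENNReal.ofReal (τ ^ (n - 1))
              = ENNReal.ofReal (τ ^ (n - 1)) := by
            intro s'
            rw [indicator_of_mem, Pi.one_apply, one_mul]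
            rw [mem_ball_zero_iff, norm_smul_sphere hτ.1]
            exact hτ.2
          simp only [this, lintegral_const, htop]
          rw [ENNReal.mul_top]
          have := hτ.1
          positivity
      _ ≤ _ := lintegral_mono_set Ioo_subset_Ioi_self
  exact absurd measure_ball_lt_top (not_lt.2 h1)

lemma polar_annulus (hσ : Polar n σ) (h : EuclideanSpace ℝ (Fin n) → ℝ≥0∞)
    (hm : Measurable h) (t : ℝ) :
    ∫⁻ x in annulus n 0 t, h x = ∫⁻ τ in Ioo (0 : ℝ) t,
      ∫⁻ s', h (τ • (s' : EuclideanSpace ℝ (Fin n))) * ENNReal.ofReal (τ ^ (n - 1)) ∂σ := by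
  have hA : MeasurableSet (annulus n 0 t) :=
    (measurableSet_lt measurable_const measurable_norm).inter
      (measurableSet_lt measurable_norm measurable_const)
  rw [← lintegral_indicator hA, hσ _ (hm.indicator hA),
    show Ioo (0 : ℝ) t = Iio t ∩ Ioi 0 from by ext; simp [and_comm],
    ← Measure.restrict_restrict measurableSet_Iio, ← lintegral_indicator measurableSet_Iio]
  refine setLIntegral_congr_fun measurableSet_Ioi fun τ hτ => ?_
  have hτ : 0 < τ := hτ
  by_cases ht : τ < t
  · rw [indicator_of_mem (show τ ∈ Iio t from ht)]
    refine lintegral_congr fun s' => ?_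
    rw [indicator_of_mem]
    simp only [annulus, mem_ofPred_eq, norm_smul_sphere hτ]
    exact ⟨hτ, ht⟩
  · rw [indicator_of_notMem (show τ ∉ Iio t from ht)]
    rw [← lintegral_zero (μ := σ)]
    refine lintegral_congr fun s' => ?_
    rw [indicator_of_notMem, zero_mul]
    simp only [annulus, mem_ofPred_eq, norm_smul_sphere hτ]
    exact fun h => ht h.2

lemma meas_slice (τ : ℝ) : Measurable
    (fun s' : Metric.sphere (0 : EuclideanSpace ℝ (Fin n)) 1 =>
      τ • (s' : EuclideanSpace ℝ (Fin n))) := by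
  fun_prop

lemma meas_int (hσ : Polar n σ) (h : EuclideanSpace ℝ (Fin n) → ℝ≥0∞) (hm : Measurable h) :
    Measurable fun τ : ℝ => ∫⁻ s', h (τ • (s' : EuclideanSpace ℝ (Fin n))) ∂σ := by
  have := sigma_finite hσ
  apply Measurable.lintegral_prod_right'
    (f := fun z : ℝ × Metric.sphere (0 : EuclideanSpace ℝ (Fin n)) 1 => h (z.1 • (z.2 : EuclideanSpace ℝ (Fin n))))
  exact hm.comp (by fun_prop)

/-- `r = τ^(n-1)` to the power `1-p`. -/
lemma pow_eq (hn : 1 ≤ n) {p : ℝ} {τ : ℝ} (hτ : 0 < τ) :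
    ENNReal.ofReal τ ^ (((n : ℝ) - 1) * (1 - p)) = ENNReal.ofReal (τ ^ (n - 1)) ^ (1 - p) := by
  rw [ENNReal.rpow_mul, ENNReal.ofReal_pow hτ.le, ← ENNReal.rpow_natCast, Nat.cast_sub hn,
    Nat.cast_one]

lemma holder_slice (hn : 1 ≤ n) {p : ℝ} (hp0 : 0 < p) (hp1 : p < 1)
    (f v : EuclideanSpace ℝ (Fin n) → ℝ≥0∞) (hf : Measurable f) (hv : Measurable v)
    {τ : ℝ} (hτ : 0 < τ) :
    ∫⁻ s', (f (τ • (s' : EuclideanSpace ℝ (Fin n))) ^ p * v (τ • (s' : EuclideanSpace ℝ (Fin n))))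
        * ENNReal.ofReal (τ ^ (n - 1)) ∂σ ≤
      (∫⁻ s', f (τ • (s' : EuclideanSpace ℝ (Fin n))) * ENNReal.ofReal (τ ^ (n - 1)) ∂σ) ^ p *
      ((∫⁻ s', v (τ • (s' : EuclideanSpace ℝ (Fin n))) ^ (1 / (1 - p)) ∂σ) ^ (1 - p) *
        ENNReal.ofReal τ ^ (((n : ℝ) - 1) * (1 - p))) := by
  have hq : 0 < 1 - p := by linarith
  set r := ENNReal.ofReal (τ ^ (n - 1)) with hr
  have hr0 : r ≠ 0 := by rw [hr]; positivity
  have hrt : r ≠ ⊤ := ENNReal.ofReal_ne_top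
  have hms := meas_slice (n := n) τ
  have hfm := hf.comp hms
  have hvm := hv.comp hms
  have hc : (1 / p).HolderConjugate (1 / (1 - p)) := by
    rw [Real.holderConjugate_iff]
    refine ⟨by rw [lt_div_iff₀ hp0]; linarith, by simp⟩
  have H := ENNReal.lintegral_mul_le_Lp_mul_Lq σ hc
    (f := fun s' => (f (τ • (s' : EuclideanSpace ℝ (Fin n))) * r) ^ p)
    (g := fun s' => v (τ • (s' : EuclideanSpace ℝ (Fin n))) * r ^ (1 - p))
    ((hfm.mul_const r).pow_const p).aemeasurable (hvm.mul_const _).aemeasurable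
  simp only [Pi.mul_apply, one_div, inv_inv] at H
  rw [pow_eq hn hτ]
  calc _ = _ := ?_
    _ ≤ _ := H
    _ = _ := ?_
  · refine lintegral_congr fun s' => ?_
    rw [ENNReal.mul_rpow_of_nonneg _ _ hp0.le]
    have hrr : r = r ^ p * r ^ (1 - p) := by
      rw [← ENNReal.rpow_add_of_nonneg _ _ hp0.le hq.le, add_sub_cancel, ENNReal.rpow_one]
    nth_rewrite 1 [hrr]
    ring
  · congr 1
    · congr 1
      refine lintegral_congr fun s' => ?_
      rw [ENNReal.rpow_rpow_inv hp0.ne']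
    · rw [← ENNReal.mul_rpow_of_nonneg _ _ hq.le, ← lintegral_mul_const]
      · congr 1
        refine lintegral_congr fun s' => ?_
        rw [ENNReal.mul_rpow_of_nonneg _ _ (inv_nonneg.2 hq.le), ENNReal.rpow_rpow_inv hq.ne',
          one_div]
      · exact hvm.pow_const _

/-- the extremal function -/
def ext0 (σ : Measure (Metric.sphere (0 : EuclideanSpace ℝ (Fin n)) 1)) (p : ℝ)
    (v : EuclideanSpace ℝ (Fin n) → ℝ≥0∞) (g : ℝ → ℝ≥0∞) (x : EuclideanSpace ℝ (Fin n)) : ℝ≥0∞ :=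
  (g ‖x‖ * (ENNReal.ofReal (‖x‖ ^ (n - 1)))⁻¹ *
    (∫⁻ s', v (‖x‖ • (s' : EuclideanSpace ℝ (Fin n))) ^ (1 / (1 - p)) ∂σ)⁻¹) * v x ^ (1 / (1 - p))

lemma meas_ext0 (hσ : Polar n σ) (p : ℝ)
    (v : EuclideanSpace ℝ (Fin n) → ℝ≥0∞) (hv : Measurable v) (g : ℝ → ℝ≥0∞) (hg : Measurable g) :
    Measurable (ext0 σ p v g) := by
  have h1 := (meas_int hσ _ (hv.pow_const (1 / (1 - p)))).comp
    (measurable_norm (α := EuclideanSpace ℝ (Fin n)))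
  have h2 := hg.comp (measurable_norm (α := EuclideanSpace ℝ (Fin n)))
  have h3 : Measurable fun x : EuclideanSpace ℝ (Fin n) => ENNReal.ofReal (‖x‖ ^ (n - 1)) := by
    fun_prop
  exact ((h2.mul h3.inv).mul h1.inv).mul (hv.pow_const _)

lemma ext0_int {p : ℝ}
    (v : EuclideanSpace ℝ (Fin n) → ℝ≥0∞) (hv : Measurable v) (g : ℝ → ℝ≥0∞)
    {τ : ℝ} (hτ : 0 < τ) :
    ∫⁻ s', ext0 σ p v g (τ • (s' : EuclideanSpace ℝ (Fin n))) * ENNReal.ofReal (τ ^ (n - 1)) ∂σ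
      ≤ g τ := by
  simp only [ext0, norm_smul_sphere hτ]
  set r := ENNReal.ofReal (τ ^ (n - 1)) with hr
  have hr0 : r ≠ 0 := by rw [hr]; positivity
  have hrt : r ≠ ⊤ := ENNReal.ofReal_ne_top
  have hm := (hv.comp (meas_slice (n := n) τ)).pow_const (1 / (1 - p))
  simp only [Function.comp_def] at hm
  rw [lintegral_mul_const _ (hm.const_mul _), lintegral_const_mul _ hm]
  set V := ∫⁻ s', v (τ • (s' : EuclideanSpace ℝ (Fin n))) ^ (1 / (1 - p)) ∂σ
  calc g τ * r⁻¹ * V⁻¹ * V * r = g τ * (r⁻¹ * r) * (V⁻¹ * V) := by ring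
    _ ≤ g τ * 1 * 1 := by
      gcongr
      · exact ENNReal.inv_mul_le_one r
      · exact ENNReal.inv_mul_le_one V
    _ = g τ := by simp

lemma ext0_eq (hn : 1 ≤ n) {p : ℝ} (hp0 : 0 < p) (hp1 : p < 1)
    (v : EuclideanSpace ℝ (Fin n) → ℝ≥0∞) (hv : Measurable v) (g : ℝ → ℝ≥0∞)
    {τ : ℝ} (hτ : 0 < τ)
    (hV : ∫⁻ s', v (τ • (s' : EuclideanSpace ℝ (Fin n))) ^ (1 / (1 - p)) ∂σ ≠ ⊤) :
    g τ ^ p * ((∫⁻ s', v (τ • (s' : EuclideanSpace ℝ (Fin n))) ^ (1 / (1 - p)) ∂σ) ^ (1 - p) *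
        ENNReal.ofReal τ ^ (((n : ℝ) - 1) * (1 - p))) =
    ∫⁻ s', (ext0 σ p v g (τ • (s' : EuclideanSpace ℝ (Fin n))) ^ p *
      v (τ • (s' : EuclideanSpace ℝ (Fin n)))) * ENNReal.ofReal (τ ^ (n - 1)) ∂σ := by
  have hq : 0 < 1 - p := by linarith
  rw [pow_eq hn hτ]
  simp only [ext0, norm_smul_sphere hτ]
  set r := ENNReal.ofReal (τ ^ (n - 1)) with hr
  have hr0 : r ≠ 0 := by rw [hr]; positivity
  have hrt : r ≠ ⊤ := ENNReal.ofReal_ne_top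
  have hm := (hv.comp (meas_slice (n := n) τ)).pow_const (1 / (1 - p))
  simp only [Function.comp_def] at hm
  set V := ∫⁻ s', v (τ • (s' : EuclideanSpace ℝ (Fin n))) ^ (1 / (1 - p)) ∂σ with hVdef
  have e : ∀ s' : Metric.sphere (0 : EuclideanSpace ℝ (Fin n)) 1,
      ((g τ * r⁻¹ * V⁻¹ * v (τ • (s' : EuclideanSpace ℝ (Fin n))) ^ (1 / (1 - p))) ^ p *
        v (τ • (s' : EuclideanSpace ℝ (Fin n)))) * r =
      (g τ ^ p * (r⁻¹ ^ p * r) * V⁻¹ ^ p) *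
        v (τ • (s' : EuclideanSpace ℝ (Fin n))) ^ (1 / (1 - p)) := by
    intro s'
    have : v (τ • (s' : EuclideanSpace ℝ (Fin n))) ^ (1 / (1 - p)) =
       (v (τ • (s' : EuclideanSpace ℝ (Fin n))) ^ (1 / (1 - p))) ^ p *
         v (τ • (s' : EuclideanSpace ℝ (Fin n))) := by
      conv_rhs => rw [← ENNReal.rpow_mul]
      nth_rewrite 3 [← ENNReal.rpow_one (v _)]
      rw [← ENNReal.rpow_add_of_nonneg _ _ (by positivity) zero_le_one]
      congr 1
      field_simp
      ring
    conv_rhs => rw [this]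
    simp only [ENNReal.mul_rpow_of_nonneg _ _ hp0.le]
    ring
  simp only [e]
  rw [lintegral_const_mul _ hm, ← hVdef]
  have key : ∀ x : ℝ≥0∞, x ≠ ⊤ → x⁻¹ ^ p * x = x ^ (1 - p) := by
    intro x hx
    by_cases hx0 : x = 0
    · simp [hx0, hq]
    · rw [ENNReal.inv_rpow, ← ENNReal.rpow_neg]
      nth_rewrite 2 [← ENNReal.rpow_one x]
      rw [← ENNReal.rpow_add _ _ hx0 hx]
      ring_nf
  rw [key r hrt, mul_assoc _ _ V, key V hV]
  ring

lemma tv_iSup {p : ℝ} (hp1 : p < 1)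
    (v : EuclideanSpace ℝ (Fin n) → ℝ≥0∞) (hv : Measurable v) (τ : ℝ) :
    (∫⁻ s', v (τ • (s' : EuclideanSpace ℝ (Fin n))) ^ (1 / (1 - p)) ∂σ) ^ (1 - p) =
    ⨆ N : ℕ, (∫⁻ s', (min (v (τ • (s' : EuclideanSpace ℝ (Fin n)))) N) ^ (1 / (1 - p)) ∂σ)
      ^ (1 - p) := by
  have hq : 0 < 1 - p := by linarith
  have hq' : 0 < 1 / (1 - p) := by positivity
  have hs : ∀ (a : ℝ) (ha : 0 < a) (h : ℕ → ℝ≥0∞), (⨆ N, h N) ^ a = ⨆ N, h N ^ a :=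
    fun a ha h => (ENNReal.orderIsoRpow a ha).map_iSup h
  rw [← hs _ hq, ← lintegral_iSup]
  · congr 1
    refine lintegral_congr fun s' => ?_
    rw [← hs _ hq']
    congr 1
    rw [← inf_iSup_eq, ENNReal.iSup_natCast, inf_top_eq]
  · intro N
    exact ((hv.comp (meas_slice (n := n) τ)).min measurable_const).pow_const _
  · intro N M h s'
    dsimp only
    gcongr

end helpers

theorem statement0 (n : ℕ) (hn : 1 ≤ n) (p q θ : ℝ)
    (hp0 : 0 < p) (hp1 : p < 1) (hq : 0 < q) (hθ : 0 < θ)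
    (u w : ℝ → ℝ≥0∞) (v : EuclideanSpace ℝ (Fin n) → ℝ≥0∞)
    (hum : Measurable u)
    (hu : ∀ᵐ t ∂(volume.restrict (Ioi (0 : ℝ))), 0 < u t ∧ u t < ⊤)
    (hwm : Measurable w)
    (hw : ∀ᵐ t ∂(volume.restrict (Ioi (0 : ℝ))), 0 < w t ∧ w t < ⊤)
    (hvm : Measurable v)
    (hv : ∀ᵐ x ∂(volume : Measure (EuclideanSpace ℝ (Fin n))), 0 < v x ∧ v x < ⊤)
    (σ : Measure (Metric.sphere (0 : EuclideanSpace ℝ (Fin n)) 1))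
    (hσ : ∀ f : EuclideanSpace ℝ (Fin n) → ℝ≥0∞, Measurable f →
      (∫⁻ x, f x) = ∫⁻ τ in Ioi (0 : ℝ),
        ∫⁻ s', f (τ • (s' : EuclideanSpace ℝ (Fin n))) * ENNReal.ofReal (τ ^ (n - 1)) ∂σ) :
    let tv : ℝ → ℝ≥0∞ := fun t =>
      (∫⁻ s', v (t • (s' : EuclideanSpace ℝ (Fin n))) ^ (1 / (1 - p)) ∂σ) ^ (1 - p) *
        ENNReal.ofReal t ^ (((n : ℝ) - 1) * (1 - p))
    let LHSn : (EuclideanSpace ℝ (Fin n) → ℝ≥0∞) → ℝ≥0∞ := fun f =>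
      (∫⁻ t in Ioi (0 : ℝ), (∫⁻ s in annulus n 0 t, f s ^ p * v s) ^ (q / p) * u t) ^ (1 / q)
    let RHSn : (EuclideanSpace ℝ (Fin n) → ℝ≥0∞) → ℝ≥0∞ := fun f =>
      (∫⁻ t in Ioi (0 : ℝ), (∫⁻ s in annulus n 0 t, f s) ^ θ * w t) ^ (1 / θ)
    let LHS1 : (ℝ → ℝ≥0∞) → ℝ≥0∞ := fun g =>
      (∫⁻ t in Ioi (0 : ℝ), (∫⁻ s in Ioo (0 : ℝ) t, g s ^ p * tv s) ^ (q / p) * u t) ^ (1 / q)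
    let RHS1 : (ℝ → ℝ≥0∞) → ℝ≥0∞ := fun g =>
      (∫⁻ t in Ioi (0 : ℝ), (∫⁻ s in Ioo (0 : ℝ) t, g s) ^ θ * w t) ^ (1 / θ)
    ((∃ C : ℝ≥0∞, C ≠ ⊤ ∧ ∀ f : EuclideanSpace ℝ (Fin n) → ℝ≥0∞, Measurable f →
        LHSn f ≤ C * RHSn f) ↔
      (∃ C' : ℝ≥0∞, C' ≠ ⊤ ∧ ∀ g : ℝ → ℝ≥0∞, Measurable g → LHS1 g ≤ C' * RHS1 g)) ∧
    sInf {C : ℝ≥0∞ | ∀ f : EuclideanSpace ℝ (Fin n) → ℝ≥0∞, Measurable f →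
        LHSn f ≤ C * RHSn f} =
      sInf {C' : ℝ≥0∞ | ∀ g : ℝ → ℝ≥0∞, Measurable g → LHS1 g ≤ C' * RHS1 g} := by
  intro tv LHSn RHSn LHS1 RHS1
  have hq1 : 0 < 1 - p := by linarith
  have hP : Polar n σ := hσ
  have := sigma_finite hP
  have hs : ∀ (a : ℝ) (ha : 0 < a) (h : ℕ → ℝ≥0∞), (⨆ N, h N) ^ a = ⨆ N, h N ^ a :=
    fun a ha h => (ENNReal.orderIsoRpow a ha).map_iSup h
  have main : ∀ C : ℝ≥0∞, (∀ f : EuclideanSpace ℝ (Fin n) → ℝ≥0∞, Measurable f →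
        LHSn f ≤ C * RHSn f) ↔ (∀ g : ℝ → ℝ≥0∞, Measurable g → LHS1 g ≤ C * RHS1 g) := by
    intro C
    constructor
    · intro H g hg
      let vN : ℕ → EuclideanSpace ℝ (Fin n) → ℝ≥0∞ := fun N x => min (v x) N
      have hvN : ∀ N, Measurable (vN N) := fun N => hvm.min measurable_const
      let tvN : ℕ → ℝ → ℝ≥0∞ := fun N t =>
        (∫⁻ s', vN N (t • (s' : EuclideanSpace ℝ (Fin n))) ^ (1 / (1 - p)) ∂σ) ^ (1 - p) *
          ENNReal.ofReal t ^ (((n : ℝ) - 1) * (1 - p))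
      have htvN : ∀ N, Measurable (tvN N) := fun N =>
        ((meas_int hP _ ((hvN N).pow_const _)).pow_const _).mul
          (ENNReal.measurable_ofReal.pow_const _)
      have hmono : ∀ t, Monotone fun N => tvN N t := by
        intro t N M h
        dsimp only [tvN, vN]
        gcongr
      have htv : ∀ t, tv t = ⨆ N, tvN N t := by
        intro t
        dsimp only [tv, tvN, vN]
        rw [tv_iSup hp1 v hvm, ENNReal.iSup_mul]
      let I : ℕ → ℝ → ℝ≥0∞ := fun N t => ∫⁻ s in Ioo (0 : ℝ) t, g s ^ p * tvN N s
      have hI : ∀ N t, I N t =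
          ∫⁻ s in annulus n 0 t, ext0 σ p (vN N) g s ^ p * vN N s := by
        intro N t
        rw [polar_annulus hP (fun s => ext0 σ p (vN N) g s ^ p * vN N s) (((meas_ext0 hP p _ (hvN N) g hg).pow_const p).mul (hvN N))]
        refine setLIntegral_congr_fun measurableSet_Ioo fun τ hτ => ?_
        refine ext0_eq hn hp0 hp1 (vN N) (hvN N) g hτ.1 ?_
        refine ne_top_of_le_ne_top (b := (N : ℝ≥0∞) ^ (1 / (1 - p)) * σ univ) ?_ ?_
        · exact ENNReal.mul_ne_top
            (ENNReal.rpow_ne_top_of_nonneg (by positivity) (ENNReal.natCast_ne_top N))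
            (measure_ne_top _ _)
        · rw [← lintegral_const]
          refine lintegral_mono fun s' => ?_
          exact ENNReal.rpow_le_rpow (min_le_right _ _) (by positivity)
      have hImono : ∀ N, Monotone (I N) := by
        intro N a b hab
        exact lintegral_mono_set (Ioo_subset_Ioo_right hab)
      have hImono' : ∀ t, Monotone fun N => I N t := by
        intro t N M h
        refine lintegral_mono fun s => ?_
        gcongr
        exact hmono s h
      have hIsup : ∀ t, ∫⁻ s in Ioo (0 : ℝ) t, g s ^ p * tv s = ⨆ N, I N t := by
        intro t
        dsimp only [I]
        rw [← lintegral_iSup]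
        · refine lintegral_congr fun s => ?_
          rw [htv, ENNReal.mul_iSup]
        · exact fun N => (hg.pow_const p).mul (htvN N)
        · intro N M h s
          dsimp only
          gcongr
          exact hmono s h
      have hqp : 0 < q / p := by positivity
      have hL : LHS1 g = ⨆ N, (∫⁻ t in Ioi (0 : ℝ), I N t ^ (q / p) * u t) ^ (1 / q) := by
        dsimp only [LHS1]
        rw [← hs _ (by positivity), ← lintegral_iSup]
        · congr 1
          refine lintegral_congr fun t => ?_
          rw [hIsup, hs _ hqp, ENNReal.iSup_mul]
        · exact fun N => ((hImono N).measurable.pow_const _).mul hum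
        · intro N M h t
          dsimp only
          gcongr
          exact hImono' t h
      rw [hL]
      refine iSup_le fun N => ?_
      have hfm := meas_ext0 hP p _ (hvN N) g hg
      calc _ ≤ LHSn (ext0 σ p (vN N) g) := by
            dsimp only [LHSn]
            gcongr with t
            rw [hI]
            gcongr with s
            exact min_le_left _ _
        _ ≤ C * RHSn (ext0 σ p (vN N) g) := H _ hfm
        _ ≤ C * RHS1 g := by
            dsimp only [RHSn, RHS1]
            gcongr with t
            rw [polar_annulus hP _ hfm]
            exact setLIntegral_mono' measurableSet_Ioo fun τ hτ => ext0_int _ (hvN N) g hτ.1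
    · intro H f hf
      let F : ℝ → ℝ≥0∞ := fun τ =>
        ∫⁻ s', f (τ • (s' : EuclideanSpace ℝ (Fin n))) * ENNReal.ofReal (τ ^ (n - 1)) ∂σ
      have hF : Measurable F := by
        have : F = fun τ => (∫⁻ s', f (τ • (s' : EuclideanSpace ℝ (Fin n))) ∂σ) *
            ENNReal.ofReal (τ ^ (n - 1)) := by
          funext τ
          exact lintegral_mul_const _ (hf.comp (meas_slice τ))
        rw [this]
        exact (meas_int hP f hf).mul (by fun_prop)
      calc LHSn f ≤ LHS1 F := by
            dsimp only [LHSn, LHS1]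
            gcongr with t
            rw [polar_annulus hP (fun s => f s ^ p * v s) ((hf.pow_const p).mul hvm)]
            exact setLIntegral_mono' measurableSet_Ioo fun τ hτ =>
              holder_slice hn hp0 hp1 f v hf hvm hτ.1
        _ ≤ C * RHS1 F := H F hF
        _ = C * RHSn f := by
            dsimp only [RHSn, RHS1]
            simp only [polar_annulus hP f hf, F]
  constructor
  · exact exists_congr fun C => and_congr_right fun _ => main C
  · congr 1
    ext C
    exact main C
end
end

section
/- Let n ≥ 1, 0 < p < 1 and 0 < q, θ < ∞. Let u, w be weights on (0,∞) and v a weight on ℝⁿ. Define ṽ(t) := (∫_{S^{n-1}} v(t s')^{1/(1-p)} dσ(s'))^{1-p} · t^{(n-1)(1-p)}. Suppose the n-dimensional inequality (∫₀^∞ (∫_{B(0,t)} f(s)^p v(s) ds)^{q/p} u(t) dt)^{1/q} ≤ C (∫₀^∞ (∫_{B(0,t)} f(s) ds)^θ w(t) dt)^{1/θ} holds with constant C for every nonnegative measurable f on ℝⁿ. Then for every nonnegative measurable g on (0,∞), (∫₀^∞ (∫₀^t g(s)^p ṽ(s) ds)^{q/p} u(t) dt)^{1/q} ≤ C (∫₀^∞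 (∫₀^t g(s) ds)^θ w(t) dt)^{1/θ}; this is obtained by testing the n-dimensional inequality with f(x) = g(|x|) (∫_{S^{n-1}} v(|x|τ')^{1/(1-p)} dσ(τ'))^{-1} v(x)^{1/(1-p)} |x|^{1-n}. -/
open MeasureTheory Set ENNReal

noncomputable section

theorem aux_finite (n : ℕ) (hn : 1 ≤ n)
    (σ : Measure (Metric.sphere (0 : EuclideanSpace ℝ (Fin n)) 1))
    (hσ : ∀ f : EuclideanSpace ℝ (Fin n) → ℝ≥0∞, Measurable f →
      (∫⁻ x, f x) = ∫⁻ τ in Ioi (0 : ℝ),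
        ∫⁻ s', f (τ • (s' : EuclideanSpace ℝ (Fin n))) * ENNReal.ofReal (τ ^ (n - 1)) ∂σ) :
    IsFiniteMeasure σ := by
  constructor
  by_contra hinf
  have hinf : σ univ = ⊤ := by simpa using hinf
  have h := hσ ((Metric.ball 0 2).indicator 1) (measurable_one.indicator Metric.isOpen_ball.measurableSet)
  rw [lintegral_indicator_one Metric.isOpen_ball.measurableSet] at h
  have hfin : volume (Metric.ball (0 : EuclideanSpace ℝ (Fin n)) 2) < ⊤ := Metric.isBounded_ball.measure_lt_top
  rw [h] at hfin
  refine absurd hfin (not_lt.mpr ?_)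
  calc (⊤ : ℝ≥0∞) = ∫⁻ τ in Ioo (0:ℝ) 1, ⊤ := by simp
    _ ≤ ∫⁻ τ in Ioo (0:ℝ) 1, ∫⁻ s', ((Metric.ball 0 2).indicator 1 (τ • (s' : EuclideanSpace ℝ (Fin n)))) * ENNReal.ofReal (τ ^ (n - 1)) ∂σ := by
        refine setLIntegral_mono' measurableSet_Ioo fun τ hτ => ?_
        have : ∀ s' : Metric.sphere (0 : EuclideanSpace ℝ (Fin n)) 1,
            (Metric.ball (0 : EuclideanSpace ℝ (Fin n)) 2).indicator (1 : EuclideanSpace ℝ (Fin n) → ℝ≥0∞) (τ • (s' : EuclideanSpace ℝ (Fin n))) = 1 := by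
          intro s'
          rw [indicator_of_mem]
          · rfl
          · have hs : ‖(s' : EuclideanSpace ℝ (Fin n))‖ = 1 := by simp
            rw [mem_ball_zero_iff, norm_smul, hs, Real.norm_eq_abs, abs_of_pos hτ.1]
            linarith [hτ.2]
        simp only [this, one_mul, lintegral_const, hinf]
        rw [ENNReal.mul_top]
        simpa using pow_pos hτ.1 _
    _ ≤ _ := lintegral_mono_set Ioo_subset_Ioi_self

theorem aux_polar (n : ℕ)
    (σ : Measure (Metric.sphere (0 : EuclideanSpace ℝ (Fin n)) 1))
    (hσ : ∀ f : EuclideanSpace ℝ (Fin n) → ℝ≥0∞, Measurable f →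
      (∫⁻ x, f x) = ∫⁻ τ in Ioi (0 : ℝ),
        ∫⁻ s', f (τ • (s' : EuclideanSpace ℝ (Fin n))) * ENNReal.ofReal (τ ^ (n - 1)) ∂σ)
    (f : EuclideanSpace ℝ (Fin n) → ℝ≥0∞) (hf : Measurable f) (t : ℝ) :
    (∫⁻ x in annulus n 0 t, f x) = ∫⁻ τ in Ioo (0 : ℝ) t,
        ∫⁻ s', f (τ • (s' : EuclideanSpace ℝ (Fin n))) * ENNReal.ofReal (τ ^ (n - 1)) ∂σ := by
  have hA : MeasurableSet (annulus n 0 t) :=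
    (measurableSet_lt measurable_const measurable_norm).inter
      (measurableSet_lt measurable_norm measurable_const)
  rw [← lintegral_indicator hA, hσ _ (hf.indicator hA)]
  have hI : Ioo (0:ℝ) t = Iio t ∩ Ioi 0 := by ext; simp [and_comm]
  rw [hI, ← Measure.restrict_restrict measurableSet_Iio, ← lintegral_indicator measurableSet_Iio]
  refine setLIntegral_congr_fun measurableSet_Ioi fun τ hτ => ?_
  have hτ : 0 < τ := hτ
  have hn : ∀ s' : Metric.sphere (0 : EuclideanSpace ℝ (Fin n)) 1,
      ‖τ • (s' : EuclideanSpace ℝ (Fin n))‖ = τ := by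
    intro s'
    have hs : ‖(s' : EuclideanSpace ℝ (Fin n))‖ = 1 := by simp
    rw [norm_smul, hs, Real.norm_eq_abs, abs_of_pos hτ, mul_one]
  by_cases h : τ < t
  · rw [indicator_of_mem (show τ ∈ Iio t from h)]
    refine lintegral_congr fun s' => ?_
    rw [indicator_of_mem]
    exact ⟨by rw [hn]; exact hτ, by rw [hn]; exact h⟩
  · rw [indicator_of_notMem (show τ ∉ Iio t from h)]
    rw [lintegral_eq_zero_iff' (by
      have : ∀ s' : Metric.sphere (0 : EuclideanSpace ℝ (Fin n)) 1, (annulus n 0 t).indicator f (τ • (s' : EuclideanSpace ℝ (Fin n))) = 0 := by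
        intro s'
        rw [indicator_of_notMem]
        exact fun h' => h (by have := h'.2; rwa [hn] at this)
      simp only [this, zero_mul]; exact aemeasurable_const)]
    refine Filter.Eventually.of_forall fun s' => ?_
    simp only
    rw [indicator_of_notMem]
    · simp
    exact fun h' => h (by have := h'.2; rwa [hn] at this)

theorem aux_iSup_rpow (f : ℕ → ℝ≥0∞) (a : ℝ) (ha : 0 < a) :
    (⨆ k, f k) ^ a = ⨆ k, f k ^ a := (ENNReal.orderIsoRpow a ha).map_iSup f

theorem aux_V_meas (n : ℕ) (σ : Measure (Metric.sphere (0 : EuclideanSpace ℝ (Fin n)) 1))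
    [IsFiniteMeasure σ] (h : EuclideanSpace ℝ (Fin n) → ℝ≥0∞) (hh : Measurable h) :
    Measurable (fun s : ℝ => ∫⁻ s', h (s • (s' : EuclideanSpace ℝ (Fin n))) ∂σ) := by
  refine Measurable.lintegral_prod_right' (f := fun z : ℝ × Metric.sphere (0 : EuclideanSpace ℝ (Fin n)) 1 => h (z.1 • (z.2 : EuclideanSpace ℝ (Fin n)))) ?_
  exact hh.comp (measurable_fst.smul (measurable_subtype_coe.comp measurable_snd))

theorem aux_main (n : ℕ) (hn : 1 ≤ n) (p q θ : ℝ)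
    (hp0 : 0 < p) (hp1 : p < 1) (hq : 0 < q) (hθ : 0 < θ)
    (u w : ℝ → ℝ≥0∞) (v v' : EuclideanSpace ℝ (Fin n) → ℝ≥0∞)
    (hvm : Measurable v) (hvm' : Measurable v') (hle : ∀ x, v' x ≤ v x)
    (K : ℝ≥0∞) (hK : K ≠ ⊤) (hvK : ∀ x, v' x ≤ K)
    (σ : Measure (Metric.sphere (0 : EuclideanSpace ℝ (Fin n)) 1)) [IsFiniteMeasure σ]
    (hσ : ∀ f : EuclideanSpace ℝ (Fin n) → ℝ≥0∞, Measurable f →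
      (∫⁻ x, f x) = ∫⁻ τ in Ioi (0 : ℝ),
        ∫⁻ s', f (τ • (s' : EuclideanSpace ℝ (Fin n))) * ENNReal.ofReal (τ ^ (n - 1)) ∂σ)
    (C : ℝ≥0∞)
    (hC : ∀ f : EuclideanSpace ℝ (Fin n) → ℝ≥0∞, Measurable f →
      (∫⁻ t in Ioi (0 : ℝ), (∫⁻ s in annulus n 0 t, f s ^ p * v s) ^ (q / p) * u t) ^ (1 / q) ≤
        C * (∫⁻ t in Ioi (0 : ℝ), (∫⁻ s in annulus n 0 t, f s) ^ θ * w t) ^ (1 / θ))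
    (g : ℝ → ℝ≥0∞) (hg : Measurable g) :
      (∫⁻ t in Ioi (0 : ℝ), (∫⁻ s in Ioo (0 : ℝ) t, g s ^ p *
          ((∫⁻ s', v' (s • (s' : EuclideanSpace ℝ (Fin n))) ^ (1 / (1 - p)) ∂σ) ^ (1 - p) *
            ENNReal.ofReal s ^ (((n : ℝ) - 1) * (1 - p)))) ^ (q / p) * u t) ^ (1 / q) ≤
        C * (∫⁻ t in Ioi (0 : ℝ), (∫⁻ s in Ioo (0 : ℝ) t, g s) ^ θ * w t) ^ (1 / θ) := by
  set V : ℝ → ℝ≥0∞ := fun s => ∫⁻ s', v' (s • (s' : EuclideanSpace ℝ (Fin n))) ^ (1 / (1 - p)) ∂σ with hV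
  have h1p : 0 < 1 - p := by linarith
  have hVm : Measurable V := aux_V_meas n σ (fun x => v' x ^ (1 / (1 - p))) (hvm'.pow_const _)
  have hVfin : ∀ s, V s ≠ ⊤ := by
    intro s
    refine ne_of_lt (lt_of_le_of_lt (lintegral_mono (g := fun _ => K ^ (1 / (1 - p))) fun s' => ?_) ?_)
    · exact ENNReal.rpow_le_rpow (hvK _) (by positivity)
    · rw [lintegral_const]
      exact ENNReal.mul_lt_top (ENNReal.rpow_lt_top_of_nonneg (by positivity) hK) (measure_lt_top _ _)
  set f : EuclideanSpace ℝ (Fin n) → ℝ≥0∞ := fun x =>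
    (g ‖x‖ * (V ‖x‖)⁻¹ * (ENNReal.ofReal (‖x‖ ^ (n - 1)))⁻¹) * v' x ^ (1 / (1 - p)) with hf
  have hfm : Measurable f := by
    have h1 : Measurable fun x : EuclideanSpace ℝ (Fin n) => g ‖x‖ := hg.comp measurable_norm
    have h2 : Measurable fun x : EuclideanSpace ℝ (Fin n) => V ‖x‖ := hVm.comp measurable_norm
    have h3 : Measurable fun x : EuclideanSpace ℝ (Fin n) => ENNReal.ofReal (‖x‖ ^ (n - 1)) := by fun_prop
    exact ((h1.mul h2.inv).mul h3.inv).mul (hvm'.pow_const _)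
  have hnorm : ∀ τ : ℝ, 0 < τ → ∀ s' : Metric.sphere (0 : EuclideanSpace ℝ (Fin n)) 1,
      ‖τ • (s' : EuclideanSpace ℝ (Fin n))‖ = τ := by
    intro τ hτ s'
    have hs : ‖(s' : EuclideanSpace ℝ (Fin n))‖ = 1 := by simp
    rw [norm_smul, hs, Real.norm_eq_abs, abs_of_pos hτ, mul_one]
  have hR0 : ∀ τ : ℝ, 0 < τ → ENNReal.ofReal (τ ^ (n - 1)) ≠ 0 := by
    intro τ hτ
    simpa using pow_pos hτ _
  have hvs : ∀ τ : ℝ, Measurable fun s' : Metric.sphere (0 : EuclideanSpace ℝ (Fin n)) 1 =>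
      v' (τ • (s' : EuclideanSpace ℝ (Fin n))) ^ (1 / (1 - p)) := by
    intro τ
    exact (hvm'.comp (measurable_subtype_coe.const_smul τ)).pow_const _
  refine le_trans (le_trans ?_ (hC f hfm)) ?_
  · refine ENNReal.rpow_le_rpow (lintegral_mono fun t => ?_) (by positivity)
    refine mul_le_mul_left (ENNReal.rpow_le_rpow ?_ (by positivity)) _
    rw [aux_polar n σ hσ (fun x => f x ^ p * v x) ((hfm.pow_const p).mul hvm)]
    refine setLIntegral_mono' measurableSet_Ioo fun τ hτ => ?_
    set R := ENNReal.ofReal (τ ^ (n - 1)) with hR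
    have hRt : R ≠ ⊤ := ENNReal.ofReal_ne_top
    have hRz : R ≠ 0 := hR0 τ hτ.1
    calc g τ ^ p * (V τ ^ (1 - p) * ENNReal.ofReal τ ^ (((n : ℝ) - 1) * (1 - p)))
        = (g τ ^ p * (V τ)⁻¹ ^ p * (R⁻¹ ^ p * R)) * V τ := by
          have e1 : ENNReal.ofReal τ ^ (((n : ℝ) - 1) * (1 - p)) = R⁻¹ ^ p * R := by
            rw [ENNReal.rpow_mul]
            have : ((n : ℝ) - 1) = ((n - 1 : ℕ) : ℝ) := by push_cast [hn]; ring
            rw [this, ENNReal.rpow_natCast, ← ENNReal.ofReal_pow hτ.1.le, ← hR,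
              ENNReal.inv_rpow, ← ENNReal.rpow_neg]
            conv_rhs => rw [← ENNReal.rpow_one R, ← ENNReal.rpow_mul, ← ENNReal.rpow_add _ _ hRz hRt]
            congr 1; ring
          have e2 : V τ ^ (1 - p) = (V τ)⁻¹ ^ p * V τ := by
            by_cases h0 : V τ = 0
            · rw [h0, mul_zero, ENNReal.zero_rpow_of_pos h1p]
            · rw [ENNReal.inv_rpow, ← ENNReal.rpow_neg]
              nth_rewrite 3 [← ENNReal.rpow_one (V τ)]
              rw [← ENNReal.rpow_add _ _ h0 (hVfin τ)]
              congr 1; ring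
          rw [e1, e2]; ring
      _ = ∫⁻ s', (g τ ^ p * (V τ)⁻¹ ^ p * (R⁻¹ ^ p * R)) * v' (τ • (s' : EuclideanSpace ℝ (Fin n))) ^ (1 / (1 - p)) ∂σ := by
          rw [lintegral_const_mul _ (hvs τ)]
      _ ≤ _ := by
          refine lintegral_mono fun s' => ?_
          simp only [hf, Pi.mul_apply, hnorm τ hτ.1 s', ← hR]
          set x := v' (τ • (s' : EuclideanSpace ℝ (Fin n)))
          rw [ENNReal.mul_rpow_of_nonneg _ _ hp0.le, ENNReal.mul_rpow_of_nonneg _ _ hp0.le, ENNReal.mul_rpow_of_nonneg _ _ hp0.le]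
          have e3 : x ^ (1 / (1 - p)) = (x ^ (1 / (1 - p))) ^ p * x := by
            rw [← ENNReal.rpow_mul]
            nth_rewrite 3 [← ENNReal.rpow_one x]
            rw [← ENNReal.rpow_add_of_nonneg _ _ (by positivity) (by positivity)]
            congr 1; field_simp; ring
          calc _ = (g τ ^ p * (V τ)⁻¹ ^ p * (R⁻¹ ^ p * R)) * ((x ^ (1 / (1 - p))) ^ p * x) := by rw [← e3]
            _ = (g τ ^ p * (V τ)⁻¹ ^ p * R⁻¹ ^ p * (x ^ (1 / (1 - p))) ^ p) * x * R := by ring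
            _ ≤ _ := by gcongr; exact hle _
  · refine mul_le_mul_right (ENNReal.rpow_le_rpow (lintegral_mono fun t => ?_) (by positivity)) _
    refine mul_le_mul_left (ENNReal.rpow_le_rpow ?_ hθ.le) _
    rw [aux_polar n σ hσ _ hfm]
    refine setLIntegral_mono' measurableSet_Ioo fun τ hτ => ?_
    set R := ENNReal.ofReal (τ ^ (n - 1)) with hR
    have hRt : R ≠ ⊤ := ENNReal.ofReal_ne_top
    have hRz : R ≠ 0 := hR0 τ hτ.1
    calc _ = ∫⁻ s', (g τ * (V τ)⁻¹ * R⁻¹ * R) * v' (τ • (s' : EuclideanSpace ℝ (Fin n))) ^ (1 / (1 - p)) ∂σ := by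
          refine lintegral_congr fun s' => ?_
          simp only [hf, hnorm τ hτ.1 s', ← hR]
          ring
      _ = (g τ * (V τ)⁻¹ * R⁻¹ * R) * V τ := by rw [lintegral_const_mul _ (hvs τ)]
      _ = g τ * ((V τ)⁻¹ * V τ) * (R⁻¹ * R) := by ring
      _ ≤ g τ * 1 * 1 := by
          gcongr
          · exact ENNReal.inv_mul_le_one _
          · exact ENNReal.inv_mul_le_one _
      _ = g τ := by simp

theorem statement1 (n : ℕ) (hn : 1 ≤ n) (p q θ : ℝ)
    (hp0 : 0 < p) (hp1 : p < 1) (hq : 0 < q) (hθ : 0 < θ)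
    (u w : ℝ → ℝ≥0∞) (v : EuclideanSpace ℝ (Fin n) → ℝ≥0∞)
    (hum : Measurable u)
    (hu : ∀ᵐ t ∂(volume.restrict (Ioi (0 : ℝ))), 0 < u t ∧ u t < ⊤)
    (hwm : Measurable w)
    (hw : ∀ᵐ t ∂(volume.restrict (Ioi (0 : ℝ))), 0 < w t ∧ w t < ⊤)
    (hvm : Measurable v)
    (hv : ∀ᵐ x ∂(volume : Measure (EuclideanSpace ℝ (Fin n))), 0 < v x ∧ v x < ⊤)
    (σ : Measure (Metric.sphere (0 : EuclideanSpace ℝ (Fin n)) 1))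
    (hσ : ∀ f : EuclideanSpace ℝ (Fin n) → ℝ≥0∞, Measurable f →
      (∫⁻ x, f x) = ∫⁻ τ in Ioi (0 : ℝ),
        ∫⁻ s', f (τ • (s' : EuclideanSpace ℝ (Fin n))) * ENNReal.ofReal (τ ^ (n - 1)) ∂σ)
    (C : ℝ≥0∞)
    (hC : ∀ f : EuclideanSpace ℝ (Fin n) → ℝ≥0∞, Measurable f →
      (∫⁻ t in Ioi (0 : ℝ), (∫⁻ s in annulus n 0 t, f s ^ p * v s) ^ (q / p) * u t) ^ (1 / q) ≤
        C * (∫⁻ t in Ioi (0 : ℝ), (∫⁻ s in annulus n 0 t, f s) ^ θ * w t) ^ (1 / θ)) :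
    ∀ g : ℝ → ℝ≥0∞, Measurable g →
      (∫⁻ t in Ioi (0 : ℝ), (∫⁻ s in Ioo (0 : ℝ) t, g s ^ p *
          ((∫⁻ s', v (s • (s' : EuclideanSpace ℝ (Fin n))) ^ (1 / (1 - p)) ∂σ) ^ (1 - p) *
            ENNReal.ofReal s ^ (((n : ℝ) - 1) * (1 - p)))) ^ (q / p) * u t) ^ (1 / q) ≤
        C * (∫⁻ t in Ioi (0 : ℝ), (∫⁻ s in Ioo (0 : ℝ) t, g s) ^ θ * w t) ^ (1 / θ) := by
  intro g hg
  haveI := aux_finite n hn σ hσ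
  have h1p : 0 < 1 - p := by linarith
  set vk : ℕ → EuclideanSpace ℝ (Fin n) → ℝ≥0∞ := fun k x => min (v x) k with hvk
  have hvkm : ∀ k, Measurable (vk k) := fun k => hvm.min measurable_const
  have hvmono : ∀ x, Monotone fun k => vk k x := fun x i j hij =>
    min_le_min le_rfl (by exact_mod_cast hij)
  have hsup : ∀ x, v x = ⨆ k, vk k x := by
    intro x
    have : v x ⊓ ⨆ k : ℕ, (k : ℝ≥0∞) = ⨆ k : ℕ, v x ⊓ (k : ℝ≥0∞) := inf_iSup_eq _ _
    rw [ENNReal.iSup_natCast, inf_top_eq] at this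
    exact this
  set W : ℕ → ℝ → ℝ≥0∞ := fun k s =>
    ∫⁻ s', vk k (s • (s' : EuclideanSpace ℝ (Fin n))) ^ (1 / (1 - p)) ∂σ with hW
  have hWm : ∀ k, Measurable (W k) := fun k =>
    aux_V_meas n σ (fun x => vk k x ^ (1 / (1 - p))) ((hvkm k).pow_const _)
  have hWmono : ∀ s, Monotone fun k => W k s := fun s i j hij =>
    lintegral_mono fun s' => ENNReal.rpow_le_rpow (hvmono _ hij) (by positivity)
  have hWsup : ∀ s : ℝ, (∫⁻ s', v (s • (s' : EuclideanSpace ℝ (Fin n))) ^ (1 / (1 - p)) ∂σ) = ⨆ k, W k s := by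
    intro s
    simp only [hW]
    rw [← lintegral_iSup]
    · refine lintegral_congr fun s' => ?_
      rw [hsup, aux_iSup_rpow _ _ (by positivity)]
    · intro k
      exact ((hvkm k).comp (measurable_subtype_coe.const_smul s)).pow_const _
    · intro i j hij s'
      exact ENNReal.rpow_le_rpow (hvmono _ hij) (by positivity)
  set F : ℕ → ℝ → ℝ≥0∞ := fun k s => g s ^ p *
          (W k s ^ (1 - p) * ENNReal.ofReal s ^ (((n : ℝ) - 1) * (1 - p))) with hF
  have hFm : ∀ k, Measurable (F k) := fun k =>
    (hg.pow_const _).mul (((hWm k).pow_const _).mul (ENNReal.measurable_ofReal.pow_const _))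
  have hFmono : Monotone F := fun i j hij s => by
    simp only [hF]
    gcongr
    exact hWmono s hij
  have hFsup : ∀ s : ℝ, g s ^ p *
          ((∫⁻ s', v (s • (s' : EuclideanSpace ℝ (Fin n))) ^ (1 / (1 - p)) ∂σ) ^ (1 - p) *
            ENNReal.ofReal s ^ (((n : ℝ) - 1) * (1 - p))) = ⨆ k, F k s := by
    intro s
    rw [hWsup, aux_iSup_rpow _ _ h1p, ENNReal.iSup_mul, ENNReal.mul_iSup]
  set G : ℕ → ℝ → ℝ≥0∞ := fun k t => (∫⁻ s in Ioo (0 : ℝ) t, F k s) ^ (q / p) * u t with hG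
  have hGm : ∀ k, Measurable (G k) := fun k => by
    refine Measurable.mul (Measurable.pow_const (Monotone.measurable ?_) _) hum
    intro a b hab
    exact lintegral_mono_set (Ioo_subset_Ioo_right hab)
  have hGmono : Monotone G := fun i j hij t => by
    simp only [hG]
    gcongr
    exact hFmono hij _
  have hqp : 0 < q / p := by positivity
  have hGsup : ∀ t : ℝ, (∫⁻ s in Ioo (0 : ℝ) t, ⨆ k, F k s) ^ (q / p) * u t = ⨆ k, G k t := by
    intro t
    rw [lintegral_iSup hFm hFmono, aux_iSup_rpow _ _ hqp, ENNReal.iSup_mul]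
  simp only [hFsup, hGsup]
  rw [lintegral_iSup hGm hGmono, aux_iSup_rpow _ _ (by positivity)]
  refine iSup_le fun k => ?_
  exact aux_main n hn p q θ hp0 hp1 hq hθ u w v (vk k) hvm (hvkm k) (fun x => min_le_left _ _)
    k (ENNReal.natCast_ne_top k) (fun x => min_le_right _ _) σ hσ C hC g hg
end
end

section
/- Let n ≥ 1, 0 < p, q < ∞, let v be a weight on ℝⁿ and w a nonnegative measurable function on (0,∞). If ∫_t^∞ w(s)^q ds = ∞ for every t > 0, then every measurable function f on ℝⁿ with ‖f‖_{LM_{p,q}(v,w)} < ∞ satisfies f = 0 almost everywhere on ℝⁿ. -/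
open MeasureTheory Set ENNReal

noncomputable section

theorem statement14 (n : ℕ) (hn : 1 ≤ n) (p q : ℝ) (hp : 0 < p) (hq : 0 < q)
    (v : EuclideanSpace ℝ (Fin n) → ℝ≥0∞) (w : ℝ → ℝ≥0∞)
    (hvm : Measurable v)
    (hv : ∀ᵐ x ∂(volume : Measure (EuclideanSpace ℝ (Fin n))), 0 < v x ∧ v x < ⊤)
    (hwm : Measurable w)
    (hW : ∀ t : ℝ, 0 < t → (∫⁻ s in Ioi t, w s ^ q) = ⊤)
    (f : EuclideanSpace ℝ (Fin n) → ℝ) (hf : Measurable f)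
    (hfin : (∫⁻ t in Ioi (0 : ℝ),
        (∫⁻ s in annulus n 0 t, ENNReal.ofReal |f s| ^ p * v s ^ p) ^ (q / p) *
          w t ^ q) ^ (1 / q) < ⊤) :
    f =ᵐ[(volume : Measure (EuclideanSpace ℝ (Fin n)))] 0 := by
  have hne : Nonempty (Fin n) := ⟨⟨0, hn⟩⟩
  set I : ℝ → ℝ≥0∞ := fun t =>
    ∫⁻ s in annulus n 0 t, ENNReal.ofReal |f s| ^ p * v s ^ p with hI
  have hqp : 0 < q / p := div_pos hq hp
  have hfin' : (∫⁻ t in Ioi (0 : ℝ), I t ^ (q / p) * w t ^ q) ≠ ⊤ := by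
    intro h
    have h2 : (∫⁻ t in Ioi (0 : ℝ), I t ^ (q / p) * w t ^ q) ^ (1 / q) < ⊤ := hfin
    rw [h, ENNReal.top_rpow_of_pos (by positivity)] at h2
    exact lt_irrefl _ h2
  have hzero : ∀ T : ℝ, 0 < T → I T = 0 := by
    intro T hT
    by_contra hne0
    apply hfin'
    rw [eq_top_iff]
    have hc : I T ^ (q / p) ≠ 0 := by
      intro h
      rw [ENNReal.rpow_eq_zero_iff_of_pos hqp] at h
      exact hne0 h
    calc (⊤ : ℝ≥0∞) = I T ^ (q / p) * ∫⁻ s in Ioi T, w s ^ q := by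
          rw [hW T hT, ENNReal.mul_top hc]
      _ = ∫⁻ s in Ioi T, I T ^ (q / p) * w s ^ q :=
          (lintegral_const_mul _ (hwm.pow_const q)).symm
      _ ≤ ∫⁻ s in Ioi T, I s ^ (q / p) * w s ^ q := by
          refine setLIntegral_mono' measurableSet_Ioi (fun s hs => ?_)
          have : I T ≤ I s :=
            lintegral_mono_set (fun y hy => ⟨hy.1, hy.2.trans hs⟩)
          gcongr
      _ ≤ _ := lintegral_mono_set (Ioi_subset_Ioi hT.le)
  have hmeas : Measurable fun s => ENNReal.ofReal |f s| ^ p * v s ^ p := by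
    have h1 : Measurable fun s => |f s| := by
      simpa only [Real.norm_eq_abs] using hf.norm
    exact (h1.ennreal_ofReal.pow_const p).mul (hvm.pow_const p)
  have hae : ∀ k : ℕ, ∀ᵐ x ∂(volume : Measure (EuclideanSpace ℝ (Fin n))),
      x ∈ annulus n 0 ((k : ℝ) + 1) → ENNReal.ofReal |f x| ^ p * v x ^ p = 0 := by
    intro k
    have hms : MeasurableSet (annulus n 0 ((k : ℝ) + 1)) :=
      (measurableSet_lt measurable_const measurable_norm).inter
        (measurableSet_lt measurable_norm measurable_const)
    have := (lintegral_eq_zero_iff hmeas).1 (hzero (k + 1) (by positivity))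
    exact (ae_restrict_iff' hms).1 this
  have h0 : ∀ᵐ x ∂(volume : Measure (EuclideanSpace ℝ (Fin n))), x ≠ 0 := by
    have : Nontrivial (EuclideanSpace ℝ (Fin n)) := inferInstance
    exact Measure.ae_ne volume 0
  filter_upwards [ae_all_iff.2 hae, hv, h0] with x hx hvx hx0
  obtain ⟨k, hk⟩ := exists_nat_gt ‖x‖
  have h := hx k ⟨norm_pos_iff.2 hx0, by linarith⟩
  rcases mul_eq_zero.1 h with h | h
  · rw [ENNReal.rpow_eq_zero_iff_of_pos hp, ENNReal.ofReal_eq_zero] at h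
    exact abs_nonpos_iff.1 h
  · rw [ENNReal.rpow_eq_zero_iff_of_pos hp] at h
    exact absurd h hvx.1.ne'
end
end
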